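/- Let $d\ge 1$ and $0<\alpha<\beta<\min(2,d)$. There exist constants $c>0$ and $C>0$ such that for all integers $n\ge 2$ and all $t>0$: $\sup_{x\in Q}\; \|(G_d)^n(t,x,\cdot)\|_{(\alpha)}^2 \le C\, t^{-\beta/2}\, e^{-ct}$. -/

import Mathlib

open MeasureTheory

/-- `φ_j(ξ) = √2 sin(jπξ)`. -/
noncomputable def phiF (j : ℕ) (ξ : ℝ) : ℝ := Real.sqrt 2 * Real.sin ((j : ℝ) * Real.pi * ξ)

/-- Green function of the heat operator on `[0,1]` with homogeneous
Dirichlet boundary conditions: `G(t,x,y) = ∑_{j≥1} e^{-j²π²t} φ_j(x) φ_j(y)`. -/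
noncomputable def G (t x y : ℝ) : ℝ :=
  ∑' j : ℕ, Real.exp (-((j : ℝ) + 1) ^ 2 * Real.pi ^ 2 * t) * phiF (j + 1) x * phiF (j + 1) y

/-- The cube `Q = [0,1]^d`. -/
def Q (d : ℕ) : Set (EuclideanSpace ℝ (Fin d)) := {x | ∀ i, x i ∈ Set.Icc (0 : ℝ) 1}

/-- `G_d(t,x,y) = ∏_i G(t,x_i,y_i)` on `Q = [0,1]^d`. -/
noncomputable def Gd (d : ℕ) (t : ℝ) (x y : EuclideanSpace ℝ (Fin d)) : ℝ :=
  ∏ i, G t (x i) (y i)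

/-- `‖φ‖_{(α)}² = ∫_Q ∫_Q |φ(y)| |y-z|^{-α} |φ(z)| dy dz`. -/
noncomputable def normAlphaSq (d : ℕ) (α : ℝ) (f : EuclideanSpace ℝ (Fin d) → ℝ) : ℝ :=
  ∫ y in Q d, ∫ z in Q d, |f y| * ‖y - z‖ ^ (-α) * |f z|

/-- `κ_n(y) = ⌊ny⌋/n`. -/
noncomputable def kappa (n : ℕ) (y : ℝ) : ℝ := (⌊(n : ℝ) * y⌋ : ℝ) / n

/-- `λ_j^n = -4n² sin²(jπ/(2n))`. -/
noncomputable def lamn (n j : ℕ) : ℝ :=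
  -4 * (n : ℝ) ^ 2 * Real.sin ((j : ℝ) * Real.pi / (2 * n)) ^ 2

/-- Piecewise-linear interpolation of `φ_j` on the grid `{i/n : 0 ≤ i ≤ n}`. -/
noncomputable def phiLin (n j : ℕ) (x : ℝ) : ℝ :=
  phiF j ((⌊(n : ℝ) * x⌋ : ℝ) / n) +
    ((n : ℝ) * x - (⌊(n : ℝ) * x⌋ : ℝ)) *
      (phiF j (((⌊(n : ℝ) * x⌋ : ℝ) + 1) / n) - phiF j ((⌊(n : ℝ) * x⌋ : ℝ) / n))

/-- Space-discretized Green function on `[0,1]`: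
`G^n(t,x,y) = ∑_{j=1}^{n-1} e^{λ_j^n t} φ_j^n(x) φ_j(κ_n(y))`. -/
noncomputable def Gn (n : ℕ) (t x y : ℝ) : ℝ :=
  ∑ j ∈ Finset.Icc 1 (n - 1), Real.exp (lamn n j * t) * phiLin n j x * phiF j (kappa n y)

/-- `(G_d)^n(t,x,y) = ∏_i G^n(t,x_i,y_i)`. -/
noncomputable def Gdn (d n : ℕ) (t : ℝ) (x y : EuclideanSpace ℝ (Fin d)) : ℝ :=
  ∏ i, Gn n t (x i) (y i)


lemma aux_tele (b : ℝ) (N : ℕ) :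
    2 * Real.sin (b / 2) * ∑ j ∈ Finset.Icc 1 N, Real.cos ((j : ℝ) * b)
      = Real.sin ((N : ℝ) * b + b / 2) - Real.sin (b / 2) := by
  induction N with
  | zero => simp
  | succ N ih =>
    rw [Finset.sum_Icc_succ_top (by omega), mul_add, ih]
    have h1 : ((N + 1 : ℕ) : ℝ) * b + b / 2 = ((N + 1 : ℕ) : ℝ) * b + b / 2 := rfl
    have h2 : (N : ℝ) * b + b / 2 = ((N + 1 : ℕ) : ℝ) * b - b / 2 := by push_cast; ring
    rw [h2, Real.sin_add, Real.sin_sub]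
    ring

noncomputable def auxF (n : ℕ) (a : ℤ) : ℝ :=
  ∑ j ∈ Finset.Icc 1 (n - 1), Real.cos ((j : ℝ) * (a * Real.pi / n)) + (1 + Real.cos (a * Real.pi)) / 2

lemma auxF_abs (n : ℕ) (hn : 1 ≤ n) (a : ℤ) : |auxF n a| ≤ n := by
  unfold auxF
  have h1 : |∑ j ∈ Finset.Icc 1 (n - 1), Real.cos ((j : ℝ) * (a * Real.pi / n))| ≤ (n : ℝ) - 1 := by
    refine (Finset.abs_sum_le_sum_abs _ _).trans ?_
    refine (Finset.sum_le_sum (fun j _ => Real.abs_cos_le_one _)).trans ?_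
    simp [Nat.cast_sub hn]
  have h2 : |(1 + Real.cos (a * Real.pi)) / 2| ≤ 1 := by
    have := Real.neg_one_le_cos (a * Real.pi)
    have := Real.cos_le_one (a * Real.pi)
    rw [abs_le]; constructor <;> linarith
  exact (abs_add_le _ _).trans (by linarith)

lemma auxF_zero (n : ℕ) (hn : 1 ≤ n) (a : ℤ) (h : auxF n a ≠ 0) : ∃ m : ℤ, a = 2 * n * m := by
  have hn0 : (n : ℝ) ≠ 0 := by positivity
  by_cases hs : Real.sin ((a * Real.pi / n) / 2) = 0
  · obtain ⟨m, hm⟩ := Real.sin_eq_zero_iff.1 hs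
    refine ⟨m, ?_⟩
    have hp := Real.pi_ne_zero
    have : (a : ℝ) = 2 * n * m := by
      field_simp at hm
      linarith
    exact_mod_cast this
  · exfalso
    apply h
    have ht := aux_tele (a * Real.pi / n) (n - 1)
    have e : ((n - 1 : ℕ) : ℝ) * (a * Real.pi / n) + (a * Real.pi / n) / 2
        = a * Real.pi - (a * Real.pi / n) / 2 := by
      rw [Nat.cast_sub hn]; field_simp; push_cast; ring
    rw [e, Real.sin_sub, Real.sin_int_mul_pi] at ht
    unfold auxF
    apply mul_left_cancel₀ hs
    linarith

lemma aux_sum_single (n : ℕ) (h : ℕ → ℝ) (C : ℝ) (hC : 0 ≤ C) (hb : ∀ l, |h l| ≤ C)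
    (hu : ∀ l < n, ∀ l' < n, h l ≠ 0 → h l' ≠ 0 → l = l') :
    ∑ l ∈ Finset.range n, |h l| ≤ C := by
  by_cases he : ∃ l < n, h l ≠ 0
  · obtain ⟨l0, h0, h1⟩ := he
    rw [Finset.sum_eq_single l0]
    · exact hb _
    · intro b hb' hne
      by_contra hc
      exact hne (hu b (Finset.mem_range.1 hb') l0 h0 (by simpa using hc) h1)
    · intro hh; exact absurd (Finset.mem_range.2 h0) hh
  · push Not at he
    rw [Finset.sum_eq_zero]
    · exact hC
    · intro l hl; simp [he l (Finset.mem_range.1 hl)]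

/-- `P_m(k,l)`. -/
noncomputable def auxP (n m : ℕ) (k : ℤ) (l : ℕ) : ℝ :=
  ∑ j ∈ Finset.Icc 1 (n - 1), (2 * Real.cos ((j : ℝ) * Real.pi / n)) ^ m *
    phiF j ((k : ℝ) / n) * phiF j ((l : ℝ) / n)

lemma auxP_zero (n : ℕ) (k : ℤ) (l : ℕ) :
    auxP n 0 k l = auxF n (k - l) - auxF n (k + l) := by
  unfold auxP auxF
  have e : Real.cos (((k - l : ℤ) : ℝ) * Real.pi) = Real.cos (((k + l : ℤ) : ℝ) * Real.pi) := by
    push_cast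
    rw [sub_mul, add_mul, Real.cos_sub, Real.cos_add, Real.sin_nat_mul_pi]; ring
  rw [e, add_sub_add_right_eq_sub, ← Finset.sum_sub_distrib]
  refine Finset.sum_congr rfl fun j _ => ?_
  unfold phiF
  have h2 : Real.sqrt 2 * Real.sqrt 2 = 2 := Real.mul_self_sqrt (by norm_num)
  have e1 : (j : ℝ) * (((k - l : ℤ) : ℝ) * Real.pi / n) = j * Real.pi * (k / n) - j * Real.pi * (l / n) := by
    push_cast; ring
  have e2 : (j : ℝ) * (((k + l : ℤ) : ℝ) * Real.pi / n) = j * Real.pi * (k / n) + j * Real.pi * (l / n) := by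
    push_cast; ring
  rw [e1, e2, Real.cos_sub, Real.cos_add, pow_zero, one_mul]
  linear_combination (Real.sin (j * Real.pi * (k / n)) * Real.sin (j * Real.pi * (l / n))) * h2

lemma auxP_succ (n m : ℕ) (k : ℤ) (l : ℕ) :
    auxP n (m + 1) k l = auxP n m (k + 1) l + auxP n m (k - 1) l := by
  unfold auxP
  rw [← Finset.sum_add_distrib]
  refine Finset.sum_congr rfl fun j _ => ?_
  have : 2 * Real.cos ((j : ℝ) * Real.pi / n) * phiF j ((k : ℝ) / n)
      = phiF j (((k + 1 : ℤ) : ℝ) / n) + phiF j (((k - 1 : ℤ) : ℝ) / n) := by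
    unfold phiF
    have e1 : (j : ℝ) * Real.pi * (((k + 1 : ℤ) : ℝ) / n) = j * Real.pi * (k / n) + j * Real.pi / n := by
      push_cast; ring
    have e2 : (j : ℝ) * Real.pi * (((k - 1 : ℤ) : ℝ) / n) = j * Real.pi * (k / n) - j * Real.pi / n := by
      push_cast; ring
    rw [e1, e2, Real.sin_add, Real.sin_sub]; ring
  rw [pow_succ]
  linear_combination ((2 * Real.cos ((j : ℝ) * Real.pi / n)) ^ m * phiF j ((l : ℝ) / n)) * this

lemma auxP_bound (n : ℕ) (hn : 1 ≤ n) (m : ℕ) : ∀ k : ℤ,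
    ∑ l ∈ Finset.range n, |auxP n m k l| ≤ 2 * n * 2 ^ m := by
  induction m with
  | zero =>
    intro k
    have h1 : ∑ l ∈ Finset.range n, |auxF n (k - l)| ≤ (n : ℝ) := by
      refine aux_sum_single n (fun l => auxF n (k - l)) n (by positivity) (fun l => auxF_abs n hn _) ?_
      intro l hl l' hl' h h'
      obtain ⟨p, hp⟩ := auxF_zero n hn _ h
      obtain ⟨q, hq⟩ := auxF_zero n hn _ h'
      have : ((l : ℤ) - l') = (n : ℤ) * (2 * (q - p)) := by linarith
      have h0 := Int.eq_zero_of_abs_lt_dvd (m := (n : ℤ)) ⟨_, this⟩ (by rw [abs_lt]; constructor <;> omega)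
      omega
    have h2 : ∑ l ∈ Finset.range n, |auxF n (k + l)| ≤ (n : ℝ) := by
      refine aux_sum_single n (fun l => auxF n (k + l)) n (by positivity) (fun l => auxF_abs n hn _) ?_
      intro l hl l' hl' h h'
      obtain ⟨p, hp⟩ := auxF_zero n hn _ h
      obtain ⟨q, hq⟩ := auxF_zero n hn _ h'
      have : ((l : ℤ) - l') = (n : ℤ) * (2 * (p - q)) := by linarith
      have h0 := Int.eq_zero_of_abs_lt_dvd (m := (n : ℤ)) ⟨_, this⟩ (by rw [abs_lt]; constructor <;> omega)
      omega
    calc _ ≤ ∑ l ∈ Finset.range n, (|auxF n (k - l)| + |auxF n (k + l)|) := by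
          refine Finset.sum_le_sum fun l _ => ?_
          rw [auxP_zero]; exact abs_sub _ _
      _ ≤ _ := by rw [Finset.sum_add_distrib]; linarith
  | succ m ih =>
    intro k
    calc _ ≤ ∑ l ∈ Finset.range n, (|auxP n m (k + 1) l| + |auxP n m (k - 1) l|) := by
          refine Finset.sum_le_sum fun l _ => ?_
          rw [auxP_succ]; exact abs_add_le _ _
      _ ≤ _ := by
        rw [Finset.sum_add_distrib, pow_succ]
        linarith [ih (k + 1), ih (k - 1)]

noncomputable def auxE (n : ℕ) (t : ℝ) (k : ℤ) (l : ℕ) : ℝ :=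
  ∑ j ∈ Finset.Icc 1 (n - 1), Real.exp (lamn n j * t) * phiF j ((k : ℝ) / n) * phiF j ((l : ℝ) / n)

lemma auxE_hasSum (n : ℕ) (hn : 1 ≤ n) (t : ℝ) (k : ℤ) (l : ℕ) :
    HasSum (fun m : ℕ => (n ^ 2 * t) ^ m / m.factorial * auxP n m k l)
      (Real.exp (2 * (n ^ 2 * t)) * auxE n t k l) := by
  unfold auxP auxE
  simp_rw [Finset.mul_sum]
  refine hasSum_sum fun j _ => ?_
  have h := NormedSpace.expSeries_div_hasSum_exp (𝔸 := ℝ) (n ^ 2 * t * (2 * Real.cos ((j : ℝ) * Real.pi / n)))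
  rw [← Real.exp_eq_exp_ℝ] at h
  have h' := h.mul_right (phiF j ((k : ℝ) / n) * phiF j ((l : ℝ) / n))
  refine (congrArg₂ (fun a b => HasSum a b) ?_ ?_).mpr h'
  · funext m; rw [mul_pow]; ring
  · rw [mul_assoc, ← mul_assoc, ← Real.exp_add]
    congr 2
    unfold lamn
    have e : (j : ℝ) * Real.pi / n = 2 * (j * Real.pi / (2 * n)) := by
      have : (n : ℝ) ≠ 0 := by positivity
      field_simp
    rw [e, Real.cos_two_mul, Real.cos_sq']; ring

lemma auxE_bound (n : ℕ) (hn : 1 ≤ n) (t : ℝ) (ht : 0 < t) (k : ℤ) :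
    ∑ l ∈ Finset.range n, |auxE n t k l| ≤ 2 * n := by
  have h1 : HasSum (fun m : ℕ => ∑ l ∈ Finset.range n, ((SignType.sign (auxE n t k l) : SignType) : ℝ) *
      ((n ^ 2 * t) ^ m / m.factorial * auxP n m k l))
      (∑ l ∈ Finset.range n, ((SignType.sign (auxE n t k l) : SignType) : ℝ) * (Real.exp (2 * (n ^ 2 * t)) * auxE n t k l)) :=
    hasSum_sum fun l _ => (auxE_hasSum n hn t k l).mul_left _
  have h2 := (NormedSpace.expSeries_div_hasSum_exp (𝔸 := ℝ) (2 * (n ^ 2 * t))).mul_left (2 * (n : ℝ))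
  rw [← Real.exp_eq_exp_ℝ] at h2
  have h3 := hasSum_le (fun m => ?_) h1 h2
  · have e : ∑ l ∈ Finset.range n, ((SignType.sign (auxE n t k l) : SignType) : ℝ) * (Real.exp (2 * (n ^ 2 * t)) * auxE n t k l)
      = (∑ l ∈ Finset.range n, |auxE n t k l|) * Real.exp (2 * (n ^ 2 * t)) := by
      rw [Finset.sum_mul]
      refine Finset.sum_congr rfl fun l _ => ?_
      rw [← sign_mul_self (auxE n t k l)]; ring
    rw [e] at h3
    exact le_of_mul_le_mul_right h3 (Real.exp_pos _)
  · have hs : 0 ≤ (n ^ 2 * t) ^ m / m.factorial := by positivity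
    calc _ ≤ ∑ l ∈ Finset.range n, (n ^ 2 * t) ^ m / m.factorial * |auxP n m k l| := by
          refine Finset.sum_le_sum fun l _ => ?_
          refine (le_abs_self _).trans ?_
          rw [abs_mul, abs_mul, abs_of_nonneg hs]
          have : |((SignType.sign (auxE n t k l) : SignType) : ℝ)| ≤ 1 := by
            cases SignType.sign (auxE n t k l) <;> simp
          exact mul_le_of_le_one_left (by positivity) this
      _ ≤ _ := by
        rw [← Finset.mul_sum]
        refine (mul_le_mul_of_nonneg_left (auxP_bound n hn m k) hs).trans (le_of_eq ?_)
        rw [mul_pow 2 (_ * t)]; ring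

lemma phiF_abs (j : ℕ) (x : ℝ) : |phiF j x| ≤ Real.sqrt 2 := by
  unfold phiF
  rw [abs_mul, abs_of_nonneg (Real.sqrt_nonneg _)]
  exact mul_le_of_le_one_right (Real.sqrt_nonneg _) (Real.abs_sin_le_one _)

lemma phiLin_eq (n j : ℕ) (x : ℝ) : phiLin n j x =
    (1 - Int.fract (n * x)) * phiF j ((⌊(n : ℝ) * x⌋ : ℝ) / n) +
      Int.fract (n * x) * phiF j (((⌊(n : ℝ) * x⌋ + 1 : ℤ) : ℝ) / n) := by
  unfold phiLin Int.fract
  push_cast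
  ring

lemma phiLin_abs (n j : ℕ) (x : ℝ) : |phiLin n j x| ≤ Real.sqrt 2 := by
  rw [phiLin_eq]
  have h0 := Int.fract_nonneg ((n : ℝ) * x)
  have h1 := (Int.fract_lt_one ((n : ℝ) * x)).le
  refine (abs_add_le _ _).trans ?_
  rw [abs_mul, abs_mul, abs_of_nonneg h0, abs_of_nonneg (sub_nonneg.2 h1)]
  have a1 := mul_le_mul_of_nonneg_left (phiF_abs j ((⌊(n : ℝ) * x⌋ : ℝ) / n)) (sub_nonneg.2 h1)
  have a2 := mul_le_mul_of_nonneg_left (phiF_abs j (((⌊(n : ℝ) * x⌋ + 1 : ℤ) : ℝ) / n)) h0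
  linarith

lemma lamn_le (n j : ℕ) (hn : 1 ≤ n) (hj : j ≤ n) : lamn n j ≤ -4 * (j : ℝ) ^ 2 := by
  unfold lamn
  have hn0 : (0 : ℝ) < n := by positivity
  have hjn : (j : ℝ) ≤ n := by exact_mod_cast hj
  have h := Real.mul_le_sin (x := (j : ℝ) * Real.pi / (2 * n)) (by positivity) (by
    rw [div_le_div_iff₀ (by positivity) (by positivity)]
    nlinarith [Real.pi_pos])
  have e : 2 / Real.pi * ((j : ℝ) * Real.pi / (2 * n)) = j / n := by
    have := Real.pi_ne_zero
    field_simp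
  rw [e] at h
  have h2 : ((j : ℝ) / n) ^ 2 ≤ Real.sin ((j : ℝ) * Real.pi / (2 * n)) ^ 2 :=
    pow_le_pow_left₀ (by positivity) h 2
  rw [div_pow, div_le_iff₀ (by positivity)] at h2
  nlinarith

lemma gauss_sum (t : ℝ) (ht : 0 < t) (N : ℕ) :
    ∑ j ∈ Finset.Icc 1 N, Real.exp (-t * (j : ℝ) ^ 2) ≤ Real.sqrt (Real.pi / t) / 2 := by
  have ha : AntitoneOn (fun x : ℝ => Real.exp (-t * x ^ 2)) (Set.Icc 0 (0 + (N : ℝ))) := by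
    intro a ha b hb hab
    apply Real.exp_le_exp.2
    have : a ^ 2 ≤ b ^ 2 := pow_le_pow_left₀ ha.1 hab 2
    nlinarith
  have h := ha.sum_le_integral
  have e : ∑ j ∈ Finset.Icc 1 N, Real.exp (-t * (j : ℝ) ^ 2)
      = ∑ i ∈ Finset.range N, Real.exp (-t * (0 + ((i + 1 : ℕ) : ℝ)) ^ 2) := by
    rw [Finset.range_eq_Ico, Finset.sum_Ico_add' (fun i : ℕ => Real.exp (-t * (0 + (i : ℝ)) ^ 2)) 0 N 1]
    simp only [zero_add]
    rfl
  rw [e]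
  refine h.trans ?_
  rw [← integral_gaussian_Ioi, intervalIntegral.integral_of_le (by positivity)]
  refine setIntegral_mono_set ?_ ?_ ?_
  · exact (integrable_exp_neg_mul_sq ht).integrableOn
  · exact .of_forall fun x => (Real.exp_pos _).le
  · exact .of_forall fun x hx => hx.1

lemma Gn_sup (n : ℕ) (hn : 1 ≤ n) (t : ℝ) (ht : 0 < t) (x y : ℝ) :
    |Gn n t x y| ≤ Real.sqrt Real.pi * t ^ (-(1 / 2) : ℝ) * Real.exp (-t) := by
  unfold Gn
  have h2 : Real.sqrt 2 * Real.sqrt 2 = 2 := Real.mul_self_sqrt (by norm_num)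
  calc _ ≤ ∑ j ∈ Finset.Icc 1 (n - 1), 2 * Real.exp (-t) * Real.exp (-t * (j : ℝ) ^ 2) := by
        refine (Finset.abs_sum_le_sum_abs _ _).trans (Finset.sum_le_sum fun j hj => ?_)
        rw [Finset.mem_Icc] at hj
        rw [abs_mul, abs_mul, abs_of_pos (Real.exp_pos _)]
        have e1 : Real.exp (lamn n j * t) ≤ Real.exp (-t) * Real.exp (-t * (j : ℝ) ^ 2) := by
          rw [← Real.exp_add]
          apply Real.exp_le_exp.2
          have := lamn_le n j hn (by omega)
          have hj1 : (1 : ℝ) ≤ j := by exact_mod_cast hj.1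
          have hj2 : (1 : ℝ) ≤ (j : ℝ) ^ 2 := by nlinarith
          nlinarith
        calc _ ≤ Real.exp (-t) * Real.exp (-t * (j : ℝ) ^ 2) * Real.sqrt 2 * Real.sqrt 2 := by
              gcongr
              · exact phiLin_abs _ _ _
              · exact phiF_abs _ _
          _ = _ := by rw [mul_assoc, h2]; ring
    _ ≤ _ := by
      rw [← Finset.mul_sum]
      have h := gauss_sum t ht (n - 1)
      rw [Real.sqrt_div Real.pi_pos.le] at h
      have e : t ^ (-(1 / 2) : ℝ) = 1 / Real.sqrt t := by
        rw [Real.rpow_neg ht.le, Real.sqrt_eq_rpow, one_div (t ^ _)]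
      rw [e]
      refine (mul_le_mul_of_nonneg_left h (by positivity)).trans (le_of_eq ?_)
      ring

lemma Gn_eq (n : ℕ) (t x y : ℝ) (l : ℕ) (h : kappa n y = l / n) : Gn n t x y =
    (1 - Int.fract (n * x)) * auxE n t ⌊(n : ℝ) * x⌋ l
      + Int.fract (n * x) * auxE n t (⌊(n : ℝ) * x⌋ + 1) l := by
  unfold Gn auxE
  rw [h, Finset.mul_sum, Finset.mul_sum, ← Finset.sum_add_distrib]
  refine Finset.sum_congr rfl fun j _ => ?_
  rw [phiLin_eq]; ring

lemma Gn_L1 (n : ℕ) (hn : 1 ≤ n) (t : ℝ) (ht : 0 < t) (x : ℝ) :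
    ∫ y in Set.Icc (0 : ℝ) 1, |Gn n t x y| ≤ 2 := by
  have hn0 : (0 : ℝ) < n := by positivity
  set c : ℕ → ℝ := fun l => (1 - Int.fract (n * x)) * |auxE n t ⌊(n : ℝ) * x⌋ l|
      + Int.fract (n * x) * |auxE n t (⌊(n : ℝ) * x⌋ + 1) l| with hc
  have h0 := Int.fract_nonneg ((n : ℝ) * x)
  have h1 := (Int.fract_lt_one ((n : ℝ) * x)).le
  have h1' := sub_nonneg.2 h1
  have hc0 : ∀ l, 0 ≤ c l := fun l => by simp only [hc]; positivity
  have hcs : ∑ l ∈ Finset.range n, c l ≤ 2 * n := by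
    simp only [hc]
    rw [Finset.sum_add_distrib, ← Finset.mul_sum, ← Finset.mul_sum]
    have a1 := mul_le_mul_of_nonneg_left (auxE_bound n hn t ht ⌊(n : ℝ) * x⌋) h1'
    have a2 := mul_le_mul_of_nonneg_left (auxE_bound n hn t ht (⌊(n : ℝ) * x⌋ + 1)) h0
    linarith
  set S : ℝ → ℝ := fun y => ∑ l ∈ Finset.range n,
    (Set.Ico ((l : ℝ) / n) ((l + 1 : ℝ) / n)).indicator (fun _ => c l) y with hS
  have hint : ∀ l ∈ Finset.range n, Integrable
      ((Set.Ico ((l : ℝ) / n) ((l + 1 : ℝ) / n)).indicator (fun _ => c l)) volume := fun l _ =>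
    (integrable_indicator_iff measurableSet_Ico).2 (integrableOn_const (by simp))
  have hSi : Integrable S volume := integrable_finsetSum _ hint
  have hS0 : ∀ y, 0 ≤ S y := fun y => Finset.sum_nonneg fun l _ =>
    Set.indicator_nonneg (fun _ _ => hc0 l) y
  have hle : ∀ y ∈ Set.Icc (0 : ℝ) 1, |Gn n t x y| ≤ S y := by
    intro y hy
    rcases eq_or_lt_of_le hy.2 with rfl | hlt
    · have : Gn n t x 1 = 0 := by
        unfold Gn
        refine Finset.sum_eq_zero fun j _ => ?_
        have : kappa n 1 = 1 := by
          unfold kappa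
          simp [hn0.ne']
        rw [this]
        unfold phiF
        simp [Real.sin_nat_mul_pi]
      rw [this, abs_zero]
      exact hS0 _
    · set l := ⌊(n : ℝ) * y⌋.toNat with hl
      have hfl : 0 ≤ ⌊(n : ℝ) * y⌋ := Int.floor_nonneg.2 (mul_nonneg hn0.le hy.1)
      have hlz : ((l : ℕ) : ℤ) = ⌊(n : ℝ) * y⌋ := Int.toNat_of_nonneg hfl
      have hlr : (l : ℝ) = (⌊(n : ℝ) * y⌋ : ℝ) := by exact_mod_cast congrArg (Int.cast : ℤ → ℝ) hlz
      have hl1 : (l : ℝ) ≤ n * y := by rw [hlr]; exact Int.floor_le _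
      have hl2 : n * y < (l : ℝ) + 1 := by rw [hlr]; exact Int.lt_floor_add_one _
      have hln : l < n := by
        have : (l : ℝ) < n := by nlinarith
        exact_mod_cast this
      have hmem : y ∈ Set.Ico ((l : ℝ) / n) ((l + 1 : ℝ) / n) := by
        constructor
        · rw [div_le_iff₀ hn0]; linarith
        · rw [lt_div_iff₀ hn0]; linarith
      have hG : |Gn n t x y| ≤ c l := by
        rw [Gn_eq n t x y l (by unfold kappa; rw [hlr])]
        refine (abs_add_le _ _).trans (le_of_eq ?_)
        rw [abs_mul, abs_mul, abs_of_nonneg h0, abs_of_nonneg h1']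
      refine hG.trans ?_
      have := Finset.single_le_sum (f := fun l : ℕ =>
        (Set.Ico ((l : ℝ) / n) ((l + 1 : ℝ) / n)).indicator (fun _ => c l) y)
        (fun i _ => Set.indicator_nonneg (fun _ _ => hc0 i) y) (Finset.mem_range.2 hln)
      simp only [Set.indicator_of_mem hmem] at this
      exact this
  calc _ ≤ ∫ y in Set.Icc (0 : ℝ) 1, S y := by
        refine integral_mono_of_nonneg (.of_forall fun _ => abs_nonneg _) hSi.integrableOn ?_
        exact (ae_restrict_iff' measurableSet_Icc).2 (.of_forall hle)
    _ ≤ ∫ y, S y := setIntegral_le_integral hSi (.of_forall hS0)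
    _ = ∑ l ∈ Finset.range n, c l / n := by
      simp only [hS]
      rw [integral_finsetSum _ hint]
      refine Finset.sum_congr rfl fun l _ => ?_
      rw [integral_indicator measurableSet_Ico, setIntegral_const, Real.volume_real_Ico_of_le (by gcongr; linarith)]
      rw [smul_eq_mul]; ring
    _ ≤ 2 := by
      rw [← Finset.sum_div, div_le_iff₀ hn0]; exact hcs

lemma Gn_L1' (n : ℕ) (hn : 1 ≤ n) (t : ℝ) (ht : 0 < t) (x : ℝ) :
    ∫ y in Set.Icc (0 : ℝ) 1, |Gn n t x y| ≤ (2 * Real.exp 1 + Real.sqrt Real.pi) * Real.exp (-t) := by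
  have hp := Real.sqrt_nonneg Real.pi
  have he := Real.exp_pos (-t)
  rcases le_total t 1 with h | h
  · refine (Gn_L1 n hn t ht x).trans ?_
    have : 1 ≤ Real.exp 1 * Real.exp (-t) := by
      rw [← Real.exp_add]; exact Real.one_le_exp (by linarith)
    nlinarith [mul_nonneg hp he.le]
  · have hle : ∫ y in Set.Icc (0 : ℝ) 1, |Gn n t x y|
        ≤ ∫ y in Set.Icc (0 : ℝ) 1, Real.sqrt Real.pi * Real.exp (-t) := by
      refine integral_mono_of_nonneg (.of_forall fun _ => abs_nonneg _)
        (integrable_const _) (.of_forall fun y => ?_)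
      refine (Gn_sup n hn t ht x y).trans ?_
      have : t ^ (-(1 / 2) : ℝ) ≤ 1 := Real.rpow_le_one_of_one_le_of_nonpos h (by norm_num)
      exact mul_le_mul_of_nonneg_right (mul_le_of_le_one_right hp this) he.le
    refine hle.trans ?_
    rw [setIntegral_const]
    simp
    nlinarith [mul_pos (Real.exp_pos 1) he]

lemma Gn_meas (n : ℕ) (t x : ℝ) : Measurable (fun y => Gn n t x y) := by
  unfold Gn phiF kappa
  fun_prop

lemma Q_eq (d : ℕ) : (@WithLp.toLp 2 (Fin d → ℝ)) ⁻¹' (Q d) = Set.univ.pi fun _ => Set.Icc (0 : ℝ) 1 := by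
  ext z; simp only [Q, Set.mem_preimage, Set.mem_setOf_eq, Set.mem_univ_pi]

lemma Q_meas (d : ℕ) : MeasurableSet (Q d) := by
  have : Q d = ⋂ i : Fin d, (fun x : EuclideanSpace ℝ (Fin d) => x i) ⁻¹' Set.Icc (0 : ℝ) 1 := by
    ext z; simp [Q]
  rw [this]
  exact MeasurableSet.iInter fun i => (by fun_prop : Measurable fun x : EuclideanSpace ℝ (Fin d) => x i) measurableSet_Icc

lemma Q_norm (d : ℕ) (y z : EuclideanSpace ℝ (Fin d)) (hy : y ∈ Q d) (hz : z ∈ Q d) :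
    ‖y - z‖ ≤ Real.sqrt d := by
  rw [EuclideanSpace.norm_eq]
  apply Real.sqrt_le_sqrt
  calc _ ≤ ∑ i : Fin d, (1 : ℝ) := by
        refine Finset.sum_le_sum fun i _ => ?_
        have h1 := hy i
        have h2 := hz i
        rw [Real.norm_eq_abs, sq_abs, PiLp.sub_apply]
        have := h1.1; have := h1.2; have := h2.1; have := h2.2
        nlinarith
    _ = d := by simp

lemma Q_vol (d : ℕ) : volume (Q d) < ⊤ := by
  rw [← (PiLp.volume_preserving_toLp (Fin d)).measure_preimage (Q_meas d).nullMeasurableSet, Q_eq,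
    volume_pi_pi]
  simp

lemma Gdn_meas (d n : ℕ) (t : ℝ) (x : EuclideanSpace ℝ (Fin d)) : Measurable (fun y => Gdn d n t x y) := by
  unfold Gdn
  refine Finset.measurable_fun_prod _ fun i _ => (Gn_meas n t (x i)).comp ?_
  fun_prop

lemma Gdn_sup (d n : ℕ) (hn : 1 ≤ n) (t : ℝ) (ht : 0 < t) (x y : EuclideanSpace ℝ (Fin d)) :
    |Gdn d n t x y| ≤ (Real.sqrt Real.pi * t ^ (-(1 / 2) : ℝ) * Real.exp (-t)) ^ d := by
  unfold Gdn
  rw [Finset.abs_prod]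
  refine (Finset.prod_le_prod (fun i _ => abs_nonneg _) (fun i _ => Gn_sup n hn t ht _ _)).trans ?_
  simp

lemma Gdn_L1 (d n : ℕ) (hn : 1 ≤ n) (t : ℝ) (ht : 0 < t) (x : EuclideanSpace ℝ (Fin d)) :
    ∫ y in Q d, |Gdn d n t x y| ≤ ((2 * Real.exp 1 + Real.sqrt Real.pi) * Real.exp (-t)) ^ d := by
  rw [← (PiLp.volume_preserving_toLp (Fin d)).setIntegral_preimage_emb
    (MeasurableEquiv.toLp 2 _).measurableEmbedding, Q_eq, volume_pi, Measure.restrict_pi_pi]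
  unfold Gdn
  simp_rw [Finset.abs_prod]
  rw [integral_fintype_prod_eq_prod (fun i (y : ℝ) => |Gn n t (x i) y|)]
  refine (Finset.prod_le_prod (fun i _ => integral_nonneg fun _ => abs_nonneg _)
    (fun i _ => Gn_L1' n hn t ht _)).trans ?_
  simp

lemma Gdn_int (d n : ℕ) (hn : 1 ≤ n) (t : ℝ) (ht : 0 < t) (x : EuclideanSpace ℝ (Fin d)) :
    IntegrableOn (fun y => |Gdn d n t x y|) (Q d) := by
  refine Measure.integrableOn_of_bounded (M := (Real.sqrt Real.pi * t ^ (-(1 / 2) : ℝ) * Real.exp (-t)) ^ d) (Q_vol d).ne ?_ ?_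
  · exact (Gdn_meas d n t x).norm.aestronglyMeasurable
  · refine .of_forall fun y => ?_
    rw [Real.norm_eq_abs, abs_abs]
    exact Gdn_sup d n hn t ht x y

lemma riesz (d : ℕ) (hd : 1 ≤ d) (γ : ℝ) (hγ : γ < d) : ∃ K : ℝ, 0 ≤ K ∧
    ∀ y ∈ Q d, IntegrableOn (fun z => ‖y - z‖ ^ (-γ)) (Q d) ∧ ∫ z in Q d, ‖y - z‖ ^ (-γ) ≤ K := by
  have : Nonempty (Fin d) := ⟨⟨0, hd⟩⟩
  have hb : IntegrableOn (fun x : EuclideanSpace ℝ (Fin d) => ‖x‖ ^ (-γ))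
      (Metric.ball 0 (Real.sqrt d + 1)) := by
    rw [integrableOn_fun_norm_addHaar volume (f := fun r : ℝ => r ^ (-γ))]
    have h1 : IntegrableOn (fun r : ℝ => r ^ ((d : ℝ) - 1 - γ)) (Set.Ioo 0 (Real.sqrt d + 1)) :=
      (intervalIntegral.integrableOn_Ioo_rpow_iff (by positivity)).2 (by linarith)
    refine h1.congr_fun (fun r hr => ?_) measurableSet_Ioo
    have hr0 : 0 < r := hr.1
    simp only [finrank_euclideanSpace, Fintype.card_fin, smul_eq_mul]
    rw [← Real.rpow_natCast, ← Real.rpow_add hr0, Nat.cast_sub hd]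
    congr 1
    push_cast; ring
  have hI : Integrable ((Metric.ball (0 : EuclideanSpace ℝ (Fin d)) (Real.sqrt d + 1)).indicator
      (fun x => ‖x‖ ^ (-γ))) := (integrable_indicator_iff measurableSet_ball).2 hb
  refine ⟨∫ x, (Metric.ball (0 : EuclideanSpace ℝ (Fin d)) (Real.sqrt d + 1)).indicator
      (fun x => ‖x‖ ^ (-γ)) x, integral_nonneg (Set.indicator_nonneg
      (fun x _ => Real.rpow_nonneg (norm_nonneg x) _)), fun y hy => ?_⟩
  have hI2 := hI.comp_sub_left y
  have hcongr : Set.EqOn (fun z => (Metric.ball (0 : EuclideanSpace ℝ (Fin d)) (Real.sqrt d + 1)).indicator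
      (fun x => ‖x‖ ^ (-γ)) (y - z)) (fun z => ‖y - z‖ ^ (-γ)) (Q d) := by
    intro z hz
    have := Q_norm d y z hy hz
    exact Set.indicator_of_mem (by rw [mem_ball_zero_iff]; linarith) _
  refine ⟨hI2.integrableOn.congr_fun hcongr (Q_meas d), ?_⟩
  rw [← setIntegral_congr_fun (Q_meas d) hcongr, ← integral_sub_left_eq_self _ volume y]
  exact setIntegral_le_integral hI2 (.of_forall fun z => Set.indicator_nonneg (fun x _ => Real.rpow_nonneg (norm_nonneg x) _) _)

lemma split_pow (α γ r s : ℝ) (hα : 0 < α) (hαγ : α ≤ γ) (hr : 0 < r) (hs : 0 ≤ s) :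
    s ^ (-α) ≤ r ^ (-α) + r ^ (γ - α) * s ^ (-γ) := by
  rcases hs.eq_or_lt with rfl | hs
  · rw [Real.zero_rpow (by linarith)]; positivity
  rcases le_total r s with h | h
  · have := Real.rpow_le_rpow_of_nonpos hr h (z := -α) (by linarith)
    have : 0 ≤ r ^ (γ - α) * s ^ (-γ) := by positivity
    linarith
  · have h1 := Real.rpow_le_rpow hs.le h (z := γ - α) (by linarith)
    have e : s ^ (-α) = s ^ (γ - α) * s ^ (-γ) := by
      rw [← Real.rpow_add hs]; congr 1; ring
    have : s ^ (γ - α) * s ^ (-γ) ≤ r ^ (γ - α) * s ^ (-γ) := by gcongr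
    have : 0 ≤ r ^ (-α) := by positivity
    linarith

lemma norm_bound (d n : ℕ) (hn : 1 ≤ n) (t : ℝ) (ht : 0 < t) (x : EuclideanSpace ℝ (Fin d))
    (α γ r K M L : ℝ) (hα : 0 < α) (hαγ : α ≤ γ) (hr : 0 < r) (hK : 0 ≤ K)
    (hKi : ∀ y ∈ Q d, IntegrableOn (fun z => ‖y - z‖ ^ (-γ)) (Q d) ∧ ∫ z in Q d, ‖y - z‖ ^ (-γ) ≤ K)
    (hM : ∀ y, |Gdn d n t x y| ≤ M) (hL : ∫ y in Q d, |Gdn d n t x y| ≤ L) :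
    normAlphaSq d α (fun y => Gdn d n t x y) ≤ L * (r ^ (-α) * L + r ^ (γ - α) * M * K) := by
  unfold normAlphaSq
  have hM0 : 0 ≤ M := (abs_nonneg _).trans (hM x)
  have hL0 : 0 ≤ L := (integral_nonneg fun _ => abs_nonneg _).trans hL
  set B := r ^ (-α) * L + r ^ (γ - α) * M * K with hB
  have hB0 : 0 ≤ B := by positivity
  have hfi := Gdn_int d n hn t ht x
  have inner : ∀ y ∈ Q d, ∫ z in Q d, |Gdn d n t x y| * ‖y - z‖ ^ (-α) * |Gdn d n t x z|
      ≤ |Gdn d n t x y| * B := by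
    intro y hy
    obtain ⟨h1, h2⟩ := hKi y hy
    have i1 : IntegrableOn (fun z => r ^ (-α) * |Gdn d n t x z|) (Q d) := hfi.const_mul _
    have i2 : IntegrableOn (fun z => r ^ (γ - α) * M * ‖y - z‖ ^ (-γ)) (Q d) := h1.const_mul _
    calc _ ≤ ∫ z in Q d, |Gdn d n t x y| *
          (r ^ (-α) * |Gdn d n t x z| + r ^ (γ - α) * M * ‖y - z‖ ^ (-γ)) := by
          refine integral_mono_of_nonneg (.of_forall fun z => by positivity)
            ((i1.add i2).const_mul _) (.of_forall fun z => ?_)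
          show |Gdn d n t x y| * ‖y - z‖ ^ (-α) * |Gdn d n t x z| ≤ _ * (_ + _)
          rw [mul_assoc]
          refine mul_le_mul_of_nonneg_left ?_ (abs_nonneg _)
          have s := mul_le_mul_of_nonneg_right (split_pow α γ r ‖y - z‖ hα hαγ hr (norm_nonneg _))
            (abs_nonneg (Gdn d n t x z))
          have s2 : r ^ (γ - α) * ‖y - z‖ ^ (-γ) * |Gdn d n t x z| ≤ r ^ (γ - α) * ‖y - z‖ ^ (-γ) * M :=
            mul_le_mul_of_nonneg_left (hM z) (by positivity)
          linarith
      _ ≤ _ := by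
        rw [integral_const_mul, integral_add i1 i2, integral_const_mul, integral_const_mul]
        refine mul_le_mul_of_nonneg_left ?_ (abs_nonneg _)
        rw [hB]
        gcongr
  calc _ ≤ ∫ y in Q d, |Gdn d n t x y| * B := by
        refine integral_mono_of_nonneg (.of_forall fun y => integral_nonneg fun z => by positivity)
          (hfi.mul_const _) ?_
        exact (ae_restrict_iff' (Q_meas d)).2 (.of_forall inner)
    _ ≤ L * B := by
      rw [integral_mul_const]
      exact mul_le_mul_of_nonneg_right hL hB0

/-- `sup_{x∈Q} ‖(G_d)^n(t,x,·)‖_{(α)}² ≤ C t^{-β/2} e^{-ct}`. -/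
theorem stmt_9 (d : ℕ) (hd : 1 ≤ d) (α β : ℝ) (hα : 0 < α) (hαβ : α < β)
    (hβ : β < min 2 (d : ℝ)) :
    ∃ c C : ℝ, 0 < c ∧ 0 < C ∧ ∀ n : ℕ, 2 ≤ n → ∀ t : ℝ, 0 < t → ∀ x ∈ Q d,
      normAlphaSq d α (fun y => Gdn d n t x y) ≤ C * t ^ (-β / 2) * Real.exp (-c * t) := by
  have hd0 : (0 : ℝ) < d := by exact_mod_cast hd
  have hβd : β < d := lt_of_lt_of_le hβ (min_le_right _ _)
  have hβ0 : 0 < β := hα.trans hαβ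
  set γ := α * d / β with hγ
  have hγd : γ < d := by rw [hγ, div_lt_iff₀ hβ0]; nlinarith
  have hαγ : α ≤ γ := by rw [hγ, le_div_iff₀ hβ0]; nlinarith
  have hγ0 : 0 < γ := hα.trans_le hαγ
  obtain ⟨K, hK, hKi⟩ := riesz d hd γ hγd
  set A := 2 * Real.exp 1 + Real.sqrt Real.pi with hA
  have hA0 : 0 < A := by positivity
  refine ⟨2 * d, A ^ d * (A ^ d + Real.sqrt Real.pi ^ d * K), by positivity, by positivity, ?_⟩
  intro n hn t ht x _
  refine (norm_bound d n (by omega) t ht x α γ (t ^ (d / (2 * γ))) K _ _ hα hαγ (by positivity) hK hKi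
    (Gdn_sup d n (by omega) t ht x) (Gdn_L1 d n (by omega) t ht x)).trans (le_of_eq ?_)
  have e1 : (t ^ (d / (2 * γ))) ^ (-α) = t ^ (-β / 2) := by
    rw [← Real.rpow_mul ht.le]
    congr 1
    rw [hγ]; field_simp
  have e2 : (t ^ (d / (2 * γ))) ^ (γ - α) * (t ^ (-(1 / 2) : ℝ)) ^ d = t ^ (-β / 2) := by
    rw [← Real.rpow_mul ht.le, ← Real.rpow_natCast, ← Real.rpow_mul ht.le, ← Real.rpow_add ht]
    congr 1
    rw [hγ]; field_simp; ring
  have e3 : Real.exp (-t) ^ d * Real.exp (-t) ^ d = Real.exp (-(2 * d) * t) := by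
    rw [← Real.exp_nat_mul, ← Real.exp_add]
    congr 1; ring
  rw [e1, ← e3, mul_pow, mul_pow, mul_pow]
  linear_combination (A ^ d * Real.exp (-t) ^ d * Real.exp (-t) ^ d * Real.sqrt Real.pi ^ d * K) * e2
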